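/- For any chain maps f, g: C → D of finite-dimensional A-module chain complexes and every n, the induced maps on the hyperquadratic Q-groups are additive in the chain map: (f+g)̂^% = f̂^% + ĝ^% : Q̂^n(C) → Q̂^n(D). -/

import Mathlib

noncomputable section
open scoped Classical

/-- The sign `(-1)^k` for `k : ℤ`. -/
def esign (k : ℤ) : ℤ := (((-1 : ℤˣ) ^ k : ℤˣ) : ℤ)

variable {A : Type} [Ring A] [StarRing A]

/-- The dual of a left `A`-module, made into a left `A`-module using the involution:
`(a • f) x = f x * star a`. -/
abbrev SDual (A : Type) [Ring A] [StarRing A] (M : Type) [AddCommGroup M] [Module A M] : Type :=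
  M →ₗ[A] A

section SDualBasics

variable {M N : Type} [AddCommGroup M] [Module A M] [AddCommGroup N] [Module A N]

instance SDual.instSMul : SMul A (SDual A M) where
  smul a f :=
    { toFun := fun x => f x * star a
      map_add' := fun x y => by simp [add_mul]
      map_smul' := fun c x => by simp [mul_assoc] }

@[simp] theorem SDual.smul_apply (a : A) (f : SDual A M) (x : M) :
    (a • f) x = f x * star a := rfl

instance SDual.instModule : Module A (SDual A M) :=
  Module.ofMinimalAxioms
    (fun a f g => by ext x; simp [add_mul])
    (fun a b f => by ext x; simp [star_add, mul_add])
    (fun a b f => by ext x; simp [star_mul, mul_assoc])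
    (fun f => by ext x; simp)

/-- The dual of an `A`-linear map. -/
def sdualMap (f : M →ₗ[A] N) : SDual A N →ₗ[A] SDual A M where
  toFun g := g.comp f
  map_add' g h := rfl
  map_smul' a g := rfl

@[simp] theorem sdualMap_apply (f : M →ₗ[A] N) (g : SDual A N) (x : M) :
    sdualMap f g x = g (f x) := rfl

/-- The canonical evaluation map `M → M**`, `x ↦ (f ↦ star (f x))`. -/
def sdualEval (A : Type) [Ring A] [StarRing A] (M : Type) [AddCommGroup M] [Module A M] :
    M →ₗ[A] SDual A (SDual A M) where
  toFun x :=
    { toFun := fun f => star (f x)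
      map_add' := fun f g => by simp [star_add]
      map_smul' := fun a f => by simp [star_mul] }
  map_add' x y := by ext f; simp [star_add]
  map_smul' a x := by ext f; simp [star_mul]

end SDualBasics

/-- The underlying graded modules of a chain complex. -/
structure PreCx (A : Type) [Ring A] [StarRing A] : Type 1 where
  Mod : ℤ → Type
  acg : ∀ r, AddCommGroup (Mod r)
  mod : ∀ r, letI := acg r; Module A (Mod r)

attribute [instance] PreCx.acg PreCx.mod

/-- A finite-dimensional chain complex of f.g. projective left `A`-modules,
together with (the automatically satisfied) reflexivity of the double duality map. -/
structure ChainCx (A : Type) [Ring A] [StarRing A] extends PreCx A : Type 1 where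
  fg : ∀ r, Module.Finite A (Mod r)
  proj : ∀ r, Module.Projective A (Mod r)
  bdd : ∃ N : ℕ, ∀ r : ℤ, (N : ℤ) < |r| → Subsingleton (Mod r)
  d : ∀ r, Mod (r + 1) →ₗ[A] Mod r
  dd : ∀ r, (d r).comp (d (r + 1)) = 0
  refl : ∀ r, Function.Bijective (sdualEval A (Mod r))

namespace ChainCx

variable (C : ChainCx A)

/-- Transport along an equality of degrees. -/
def cst : ∀ {r r' : ℤ}, r = r' → (C.Mod r →ₗ[A] C.Mod r')
  | _, _, rfl => LinearMap.id

/-- Transport of duals along an equality of degrees. -/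
def dcst {r r' : ℤ} (h : r = r') : SDual A (C.Mod r) →ₗ[A] SDual A (C.Mod r') :=
  sdualMap (C.cst h.symm)

/-- The inverse of the double duality map. -/
def coev (r : ℤ) : SDual A (SDual A (C.Mod r)) →ₗ[A] C.Mod r :=
  (LinearEquiv.ofBijective (sdualEval A (C.Mod r)) (C.refl r)).symm.toLinearMap

/-- The transposition `T` on maps `C^p → C_q`, using the identification `M** = M`. -/
def T (p q : ℤ) (θ : SDual A (C.Mod p) →ₗ[A] C.Mod q) :
    SDual A (C.Mod q) →ₗ[A] C.Mod p :=
  esign (p * q) • ((C.coev p).comp (sdualMap θ))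

/-- The transposition `T` on maps `C_p → C^q`, using the identification `M** = M`. -/
def Tb (p q : ℤ) (θ : C.Mod p →ₗ[A] SDual A (C.Mod q)) :
    C.Mod q →ₗ[A] SDual A (C.Mod p) :=
  esign (p * q) • ((sdualMap θ).comp (sdualEval A (C.Mod q)))

/-- The dual differential `C^a → C^b` (where `b = a + 1`). -/
def dstarTo {a b : ℤ} (h : b = a + 1) : SDual A (C.Mod a) →ₗ[A] SDual A (C.Mod b) :=
  sdualMap ((C.d a).comp (C.cst h))

end ChainCx

/-- The group of `n`-dimensional symmetric chains `{φ_s : C^{n-r+s} → C_r}`. -/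
abbrev SymCh (C : ChainCx A) (n : ℤ) : Type :=
  ∀ (s : ℕ) (r : ℤ), SDual A (C.Mod (n - r + (s : ℤ))) →ₗ[A] C.Mod r

/-- The group of `n`-dimensional quadratic chains `{ψ_s : C^{n-r-s} → C_r}`. -/
abbrev QuadCh (C : ChainCx A) (n : ℤ) : Type :=
  ∀ (s : ℕ) (r : ℤ), SDual A (C.Mod (n - r - (s : ℤ))) →ₗ[A] C.Mod r

/-- The group of `n`-dimensional hyperquadratic chains `{θ_s : C^{n-r+s} → C_r}, s ∈ ℤ`. -/
abbrev HypCh (C : ChainCx A) (n : ℤ) : Type :=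
  ∀ (s : ℤ) (r : ℤ), SDual A (C.Mod (n - r + s)) →ₗ[A] C.Mod r

variable (C : ChainCx A)

/-- Reindexing of symmetric chains along an equality of dimensions. -/
def symCastDim {n n' : ℤ} (h : n = n') (φ : SymCh C n) : SymCh C n' := fun s r =>
  (φ s r).comp (C.dcst (show n' - r + (s : ℤ) = n - r + (s : ℤ) by rw [h]))

/-- Reindexing of quadratic chains along an equality of dimensions. -/
def quadCastDim {n n' : ℤ} (h : n = n') (ψ : QuadCh C n) : QuadCh C n' := fun s r =>
  (ψ s r).comp (C.dcst (show n' - r - (s : ℤ) = n - r - (s : ℤ) by rw [h]))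

/-- Reindexing of hyperquadratic chains along an equality of dimensions. -/
def hypCastDim {n n' : ℤ} (h : n = n') (θ : HypCh C n) : HypCh C n' := fun s r =>
  (θ s r).comp (C.dcst (show n' - r + s = n - r + s by rw [h]))

/-- The boundary of an `(n+1)`-dimensional symmetric chain:
`(dξ)_s = d ξ_s + (-1)^r ξ_s d* + (-1)^{n+s} (ξ_{s-1} + (-1)^s T ξ_{s-1})`. -/
def symBnd (n : ℤ) (ξ : SymCh C (n + 1)) : SymCh C n
  | s, r =>
    (C.d r).comp ((ξ s (r + 1)).comp
        (C.dcst (show n - r + (s : ℤ) = n + 1 - (r + 1) + (s : ℤ) by ring)))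
    + esign r • ((ξ s r).comp
        (C.dstarTo (show n + 1 - r + (s : ℤ) = (n - r + (s : ℤ)) + 1 by ring)))
    + (match s with
      | 0 => 0
      | (t + 1) =>
        esign (n + 1 + t) • (
          (ξ t r).comp (C.dcst (show n - r + ((t + 1 : ℕ) : ℤ) = n + 1 - r + (t : ℤ) by
            push_cast; ring))
          + esign ((t : ℤ) + 1) •
            ((C.cst (show n + 1 - (n - r + ((t + 1 : ℕ) : ℤ)) + (t : ℤ) = r by push_cast; ring)).comp
              (C.T _ _ (ξ t (n - r + ((t + 1 : ℕ) : ℤ)))))))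

/-- The boundary of an `(n+1)`-dimensional quadratic chain:
`(dχ)_s = d χ_s + (-1)^r χ_s d* + (-1)^{n-s} (χ_{s+1} + (-1)^{s+1} T χ_{s+1})`. -/
def quadBnd (n : ℤ) (χ : QuadCh C (n + 1)) : QuadCh C n := fun s r =>
  (C.d r).comp ((χ s (r + 1)).comp
      (C.dcst (show n - r - (s : ℤ) = n + 1 - (r + 1) - (s : ℤ) by ring)))
  + esign r • ((χ s r).comp
      (C.dstarTo (show n + 1 - r - (s : ℤ) = (n - r - (s : ℤ)) + 1 by ring)))
  + esign (n - s) • (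
      (χ (s + 1) r).comp (C.dcst (show n - r - (s : ℤ) = n + 1 - r - ((s + 1 : ℕ) : ℤ) by
        push_cast; ring))
      + esign ((s : ℤ) + 1) •
        ((C.cst (show n + 1 - (n - r - (s : ℤ)) - ((s + 1 : ℕ) : ℤ) = r by push_cast; ring)).comp
          (C.T _ _ (χ (s + 1) (n - r - (s : ℤ))))))

/-- The boundary of an `(n+1)`-dimensional hyperquadratic chain. -/
def hypBnd (n : ℤ) (ν : HypCh C (n + 1)) : HypCh C n := fun s r =>
  (C.d r).comp ((ν s (r + 1)).comp
      (C.dcst (show n - r + s = n + 1 - (r + 1) + s by ring)))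
  + esign r • ((ν s r).comp
      (C.dstarTo (show n + 1 - r + s = (n - r + s) + 1 by ring)))
  + esign (n + s) • (
      (ν (s - 1) r).comp (C.dcst (show n - r + s = n + 1 - r + (s - 1) by ring))
      + esign s •
        ((C.cst (show n + 1 - (n - r + s) + (s - 1) = r by ring)).comp
          (C.T _ _ (ν (s - 1) (n - r + s)))))

/-- `φ` is an `n`-dimensional symmetric structure on `C`. -/
def IsSymStr (n : ℤ) (φ : SymCh C n) : Prop :=
  symBnd C (n - 1) (symCastDim C (show n = (n - 1) + 1 by ring) φ) = 0

/-- `ψ` is an `n`-dimensional quadratic structure on `C`. -/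
def IsQuadStr (n : ℤ) (ψ : QuadCh C n) : Prop :=
  quadBnd C (n - 1) (quadCastDim C (show n = (n - 1) + 1 by ring) ψ) = 0

/-- `θ` is an `n`-dimensional hyperquadratic structure on `C`. -/
def IsHypStr (n : ℤ) (θ : HypCh C n) : Prop :=
  hypBnd C (n - 1) (hypCastDim C (show n = (n - 1) + 1 by ring) θ) = 0

/-- The subgroup of `n`-dimensional symmetric structures (cycles). -/
def symCycles (n : ℤ) : AddSubgroup (SymCh C n) := AddSubgroup.closure {φ | IsSymStr C n φ}

/-- The subgroup of boundaries of symmetric chains. -/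
def symBdrys (n : ℤ) : AddSubgroup (SymCh C n) := AddSubgroup.closure (Set.range (symBnd C n))

/-- The symmetric `Q`-group `Q^n(C)`. -/
def Qsym (n : ℤ) : Type := symCycles C n ⧸ ((symBdrys C n).addSubgroupOf (symCycles C n))

instance (n : ℤ) : AddCommGroup (Qsym C n) :=
  inferInstanceAs (AddCommGroup (_ ⧸ (_ : AddSubgroup _)))

/-- The class of a symmetric structure in `Q^n(C)`. -/
def mkSym (n : ℤ) (φ : SymCh C n) (h : IsSymStr C n φ) : Qsym C n :=
  QuotientAddGroup.mk ⟨φ, AddSubgroup.subset_closure h⟩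

def quadCycles (n : ℤ) : AddSubgroup (QuadCh C n) := AddSubgroup.closure {ψ | IsQuadStr C n ψ}

def quadBdrys (n : ℤ) : AddSubgroup (QuadCh C n) := AddSubgroup.closure (Set.range (quadBnd C n))

/-- The quadratic `Q`-group `Q_n(C)`. -/
def Qquad (n : ℤ) : Type := quadCycles C n ⧸ ((quadBdrys C n).addSubgroupOf (quadCycles C n))

instance (n : ℤ) : AddCommGroup (Qquad C n) :=
  inferInstanceAs (AddCommGroup (_ ⧸ (_ : AddSubgroup _)))

def mkQuad (n : ℤ) (ψ : QuadCh C n) (h : IsQuadStr C n ψ) : Qquad C n :=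
  QuotientAddGroup.mk ⟨ψ, AddSubgroup.subset_closure h⟩

def hypCycles (n : ℤ) : AddSubgroup (HypCh C n) := AddSubgroup.closure {θ | IsHypStr C n θ}

def hypBdrys (n : ℤ) : AddSubgroup (HypCh C n) := AddSubgroup.closure (Set.range (hypBnd C n))

/-- The hyperquadratic `Q`-group `Q̂^n(C)`. -/
def Qhyp (n : ℤ) : Type := hypCycles C n ⧸ ((hypBdrys C n).addSubgroupOf (hypCycles C n))

instance (n : ℤ) : AddCommGroup (Qhyp C n) :=
  inferInstanceAs (AddCommGroup (_ ⧸ (_ : AddSubgroup _)))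

def mkHyp (n : ℤ) (θ : HypCh C n) (h : IsHypStr C n θ) : Qhyp C n :=
  QuotientAddGroup.mk ⟨θ, AddSubgroup.subset_closure h⟩

/-- The symmetrization `(1+T)ψ` of a quadratic chain. -/
def oneTchain (n : ℤ) (ψ : QuadCh C n) : SymCh C n
  | 0, r =>
    (ψ 0 r).comp (C.dcst (show n - r + ((0 : ℕ) : ℤ) = n - r - ((0 : ℕ) : ℤ) by push_cast; ring))
    + (C.cst (show n - (n - r + ((0 : ℕ) : ℤ)) - ((0 : ℕ) : ℤ) = r by push_cast; ring)).comp
        (C.T _ _ (ψ 0 (n - r + ((0 : ℕ) : ℤ))))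
  | (_ + 1), _ => 0

/-- The map `J` from symmetric to hyperquadratic chains. -/
def Jchain (n : ℤ) (φ : SymCh C n) : HypCh C n := fun s r =>
  if h : 0 ≤ s then
    (φ s.toNat r).comp (C.dcst (by rw [Int.toNat_of_nonneg h]))
  else 0

/-- The map `H` from hyperquadratic to quadratic chains, `ψ_s = θ_{-s-1}`. -/
def Hchain (n : ℤ) (θ : HypCh C n) : QuadCh C (n - 1) := fun s r =>
  (θ (-(s : ℤ) - 1) r).comp
    (C.dcst (show n - 1 - r - (s : ℤ) = n - r + (-(s : ℤ) - 1) by ring))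

/-- A chain map of chain complexes over `A`. -/
structure ChainMap (C D : ChainCx A) : Type where
  f : ∀ r, C.Mod r →ₗ[A] D.Mod r
  comm : ∀ r, (f r).comp (C.d r) = (D.d r).comp (f (r + 1))

/-- Chain homotopy of chain maps. -/
def ChainHtpy {C D : ChainCx A} (F G : ChainMap C D) : Prop :=
  ∃ g : ∀ r, C.Mod r →ₗ[A] D.Mod (r + 1),
    ∀ r, F.f (r + 1) - G.f (r + 1) = (D.d (r + 1)).comp (g (r + 1)) + (g r).comp (C.d r)

/-- The identity chain map. -/
def ChainMap.idCM (C : ChainCx A) : ChainMap C C :=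
  ⟨fun _ => LinearMap.id, fun r => by simp⟩

/-- Composition of chain maps. -/
def ChainMap.compCM {C D E : ChainCx A} (G : ChainMap D E) (F : ChainMap C D) : ChainMap C E :=
  ⟨fun r => (G.f r).comp (F.f r), fun r => by
    rw [LinearMap.comp_assoc, F.comm, ← LinearMap.comp_assoc, G.comm, LinearMap.comp_assoc]⟩

/-- Sum of chain maps. -/
def ChainMap.addCM {C D : ChainCx A} (F G : ChainMap C D) : ChainMap C D :=
  ⟨fun r => F.f r + G.f r, fun r => by
    rw [LinearMap.add_comp, LinearMap.comp_add, F.comm, G.comm]⟩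

/-- A chain map is a chain homotopy equivalence. -/
def IsChainEquiv {C D : ChainCx A} (F : ChainMap C D) : Prop :=
  ∃ G : ChainMap D C, ChainHtpy (G.compCM F) (ChainMap.idCM C) ∧
    ChainHtpy (F.compCM G) (ChainMap.idCM D)

/-- The induced map on symmetric chains, `φ_s ↦ f φ_s f*`. -/
def fSym {C D : ChainCx A} (F : ChainMap C D) (n : ℤ) (φ : SymCh C n) : SymCh D n := fun s r =>
  (F.f r).comp ((φ s r).comp (sdualMap (F.f (n - r + (s : ℤ)))))

/-- The induced map on quadratic chains. -/
def fQuad {C D : ChainCx A} (F : ChainMap C D) (n : ℤ) (ψ : QuadCh C n) : QuadCh D n := fun s r =>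
  (F.f r).comp ((ψ s r).comp (sdualMap (F.f (n - r - (s : ℤ)))))

/-- The induced map on hyperquadratic chains. -/
def fHyp {C D : ChainCx A} (F : ChainMap C D) (n : ℤ) (θ : HypCh C n) : HypCh D n := fun s r =>
  (F.f r).comp ((θ s r).comp (sdualMap (F.f (n - r + s))))

/-- `Q` is the group homomorphism `Q̂^n(C) → Q̂^n(D)` induced by the chain map `F`. -/
def IsInducedHyp {C D : ChainCx A} (F : ChainMap C D) (n : ℤ) (Q : Qhyp C n →+ Qhyp D n) : Prop :=
  ∀ (θ : HypCh C n) (h1 : IsHypStr C n θ) (h2 : IsHypStr D n (fHyp F n θ)),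
    Q (mkHyp C n θ h1) = mkHyp D n (fHyp F n θ) h2

theorem esign_add (a b : ℤ) : esign (a + b) = esign a * esign b := by
  simp [esign, zpow_add]

theorem esign_add_one (a : ℤ) : esign (a + 1) = -esign a := by
  simp [esign, zpow_add]

theorem esign_eq_or (a : ℤ) : esign a = 1 ∨ esign a = -1 := by
  rcases Int.units_eq_one_or ((-1 : ℤˣ) ^ a) with h | h <;> simp [esign, h]

theorem esign_mul_self (a : ℤ) : esign a * esign a = 1 := by
  rcases esign_eq_or a with h | h <;> simp [h]

namespace ChainCx

variable {C D : ChainCx A}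

theorem apply_coev (r : ℤ) (F : SDual A (SDual A (C.Mod r))) (y : SDual A (C.Mod r)) :
    y (C.coev r F) = star (F y) := by
  have h : sdualEval A (C.Mod r) (C.coev r F) = F :=
    (LinearEquiv.ofBijective (sdualEval A (C.Mod r)) (C.refl r)).apply_symm_apply F
  have h' : star (y (C.coev r F)) = F y := LinearMap.congr_fun h y
  rw [← h', star_star]

theorem apply_T {p q : ℤ} (θ : SDual A (C.Mod p) →ₗ[A] C.Mod q)
    (x : SDual A (C.Mod q)) (y : SDual A (C.Mod p)) :
    y (C.T p q θ x) = esign (p * q) • star (x (θ y)) := by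
  simp only [T, LinearMap.smul_apply, map_zsmul, LinearMap.comp_apply, apply_coev,
    sdualMap_apply]

/-- Elements of a reflexive module are separated by linear forms. -/
theorem ext_dual {r : ℤ} {u v : C.Mod r} (h : ∀ y : SDual A (C.Mod r), y u = y v) : u = v :=
  (C.refl r).1 (LinearMap.ext fun y => congrArg star (h y))

theorem T_T {p q : ℤ} (θ : SDual A (C.Mod p) →ₗ[A] C.Mod q) :
    C.T q p (C.T p q θ) = θ := by
  refine LinearMap.ext fun x => ext_dual fun y => ?_
  rw [apply_T, apply_T, mul_comm q p]
  rcases esign_eq_or (p * q) with h | h <;> simp [h]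

theorem T_add {p q : ℤ} (θ η : SDual A (C.Mod p) →ₗ[A] C.Mod q) :
    C.T p q (θ + η) = C.T p q θ + C.T p q η := by
  refine LinearMap.ext fun x => ext_dual fun y => ?_
  simp [apply_T]

theorem T_zsmul {p q : ℤ} (k : ℤ) (θ : SDual A (C.Mod p) →ₗ[A] C.Mod q) :
    C.T p q (k • θ) = k • C.T p q θ := by
  refine LinearMap.ext fun x => ext_dual fun y => ?_
  simp only [apply_T, LinearMap.smul_apply, map_zsmul, star_zsmul]
  rw [smul_comm]

theorem T_zero {p q : ℤ} : C.T p q 0 = 0 := by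
  simpa using T_zsmul (C := C) (p := p) (q := q) 0 0

theorem T_conj {p q : ℤ} (θ : SDual A (C.Mod p) →ₗ[A] C.Mod q)
    (F : C.Mod p →ₗ[A] D.Mod p) (G : C.Mod q →ₗ[A] D.Mod q) :
    D.T p q (G.comp (θ.comp (sdualMap F))) = F.comp ((C.T p q θ).comp (sdualMap G)) := by
  refine LinearMap.ext fun x => ext_dual fun y => ?_
  exact (apply_T _ _ _).trans (apply_T θ (sdualMap G x) (sdualMap F y)).symm

theorem T_d_comp {p q : ℤ} (θ : SDual A (C.Mod p) →ₗ[A] C.Mod (q + 1)) :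
    C.T p q ((C.d q).comp θ) = esign p • (C.T p (q + 1) θ).comp (sdualMap (C.d q)) := by
  refine LinearMap.ext fun x => ext_dual fun y => ?_
  have h := apply_T θ (sdualMap (C.d q) x) y
  rw [apply_T, LinearMap.smul_apply, map_zsmul]
  change _ = esign p • y (C.T p (q + 1) θ (sdualMap (C.d q) x))
  rw [h, smul_smul, mul_add, mul_one, esign_add, mul_left_comm, esign_mul_self, mul_one]
  rfl

theorem T_comp_d {p q : ℤ} (θ : SDual A (C.Mod (p + 1)) →ₗ[A] C.Mod q) :
    C.T p q (θ.comp (sdualMap (C.d p))) = esign q • (C.d p).comp (C.T (p + 1) q θ) := by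
  refine LinearMap.ext fun x => ext_dual fun y => ?_
  have h := apply_T θ x (sdualMap (C.d p) y)
  rw [apply_T, LinearMap.smul_apply, map_zsmul]
  change _ = esign q • (sdualMap (C.d p) y) (C.T (p + 1) q θ x)
  rw [h, smul_smul, add_mul, one_mul, esign_add, mul_left_comm, esign_mul_self, mul_one]
  rfl

end ChainCx

namespace HypCh

variable {C D : ChainCx A}

/-- The component `C^p → C_q` of a hyperquadratic chain, for any `p` equal to `n - q + s`. -/
def comp {n : ℤ} (θ : HypCh C n) (s p q : ℤ) (h : p = n - q + s) :
    SDual A (C.Mod p) →ₗ[A] C.Mod q :=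
  (θ s q).comp (C.dcst h)

theorem comp_self {n : ℤ} (θ : HypCh C n) (s q : ℤ) : comp θ s (n - q + s) q rfl = θ s q := rfl

theorem comp_hypCastDim {n n' : ℤ} (hn : n = n') (θ : HypCh C n) (s p q : ℤ)
    (h : p = n' - q + s) :
    comp (hypCastDim C hn θ) s p q h = comp θ s p q (hn ▸ h) := by
  subst hn; subst h; rfl

theorem ext_comp {n : ℤ} {θ η : HypCh C n}
    (H : ∀ s p q h, comp θ s p q h = comp η s p q h) : θ = η :=
  funext fun s => funext fun r => H s _ r rfl

theorem comp_fHyp (F : ChainMap C D) {n : ℤ} (θ : HypCh C n) (s p q : ℤ) (h : p = n - q + s) :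
    comp (fHyp F n θ) s p q h = (F.f q).comp ((comp θ s p q h).comp (sdualMap (F.f p))) := by
  subst h; rfl

theorem dcst_comp_sdualMap_d {a a' : ℤ} (h : a' = a + 1) (e : a + 1 = a') :
    (C.dcst e).comp (sdualMap (C.d a)) = C.dstarTo h := by
  subst h; rfl

theorem cst_comp_T {p q r : ℤ} (h : p = r) (θ : SDual A (C.Mod p) →ₗ[A] C.Mod q) :
    (C.cst h).comp (C.T p q θ) = C.T r q (θ.comp (C.dcst h.symm)) := by
  subst h; rfl

theorem comp_hypBnd {n : ℤ} (ν : HypCh C (n + 1)) {s t p r : ℤ} (ht : s = t + 1)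
    (h : p = n - r + s) :
    comp (hypBnd C n ν) s p r h =
      (C.d r).comp (comp ν s p (r + 1) (by omega))
      + esign r • (comp ν s (p + 1) r (by omega)).comp (sdualMap (C.d p))
      + esign (n + s) • (comp ν t p r (by omega)
        + esign s • C.T r p (comp ν t r p (by omega))) := by
  obtain rfl : t = s - 1 := by omega
  subst h
  rw [comp_self]
  unfold hypBnd
  rw [cst_comp_T, ← dcst_comp_sdualMap_d _ (by omega)]
  rfl

theorem hypBnd_fHyp (F : ChainMap C D) (n : ℤ) (ν : HypCh C (n + 1)) :
    hypBnd D n (fHyp F (n + 1) ν) = fHyp F n (hypBnd C n ν) := by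
  refine ext_comp fun s p r h => ?_
  have hs : s = (s - 1) + 1 := by omega
  rw [comp_fHyp, comp_hypBnd _ hs, comp_hypBnd _ hs]
  simp only [comp_fHyp, ChainCx.T_conj]
  have h1 := F.comm r
  have h2 : (sdualMap (F.f (p + 1))).comp (sdualMap (D.d p))
      = (sdualMap (C.d p)).comp (sdualMap (F.f p)) := congrArg sdualMap (F.comm p).symm
  simp only [LinearMap.comp_add, LinearMap.add_comp, LinearMap.comp_smul, LinearMap.smul_comp,
    LinearMap.comp_assoc, h2]
  simp only [← LinearMap.comp_assoc, h1]

theorem fHyp_hypCastDim (F : ChainMap C D) {n n' : ℤ} (h : n = n') (θ : HypCh C n) :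
    fHyp F n' (hypCastDim C h θ) = hypCastDim D h (fHyp F n θ) := by
  subst h; rfl

theorem isHypStr_fHyp (F : ChainMap C D) {n : ℤ} {θ : HypCh C n} (h : IsHypStr C n θ) :
    IsHypStr D n (fHyp F n θ) := by
  unfold IsHypStr at h ⊢
  rw [← fHyp_hypCastDim, hypBnd_fHyp, h]
  refine funext fun s => funext fun r => ?_
  simp [fHyp]

/-- The transpose of the cocycle relation of a hyperquadratic structure. -/
theorem transpose_cocycle {n : ℤ} {θ : HypCh C n} (hθ : IsHypStr C n θ) {s p r : ℤ}
    (h : p = n - r + s) :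
    (C.d r).comp (C.T (r + 1) p (comp θ (s + 1) (r + 1) p (by omega)))
      + esign r • (C.T r (p + 1) (comp θ (s + 1) r (p + 1) (by omega))).comp (sdualMap (C.d p))
      + esign (n + s) • (C.T r p (comp θ s r p (by omega))
        - esign s • comp θ s p r h) = 0 := by
  have H : comp (hypBnd C (n - 1) (hypCastDim C (show n = (n - 1) + 1 by ring) θ)) (s + 1) r p
      (by omega) = 0 := by
    rw [show hypBnd C (n - 1) (hypCastDim C (show n = (n - 1) + 1 by ring) θ) = 0 from hθ]
    rfl
  rw [comp_hypBnd _ (rfl : s + 1 = s + 1)] at H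
  simp only [comp_hypCastDim] at H
  have H' := congrArg (C.T r p) H
  simp only [ChainCx.T_add, ChainCx.T_zsmul, ChainCx.T_d_comp, ChainCx.T_comp_d, ChainCx.T_T,
    ChainCx.T_zero, smul_smul, esign_mul_self, one_smul] at H'
  rw [show n - 1 + (s + 1) = n + s by ring, esign_add_one] at H'
  linear_combination (norm := module) (1 : ℤ) • H'

/-- The chain `ν_s = (-1)^n f (T θ_{s+1}) g*`, which bounds the cross term of
`(f + g)θ(f + g)*`. -/
def crossChain (f g : ChainMap C D) {n : ℤ} (θ : HypCh C n) : HypCh D (n + 1) := fun s r =>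
  esign n • (f.f r).comp
    ((C.T r (n + 1 - r + s) (comp θ (s + 1) r (n + 1 - r + s) (by omega))).comp
      (sdualMap (g.f (n + 1 - r + s))))

theorem comp_crossChain (f g : ChainMap C D) {n : ℤ} (θ : HypCh C n) {s t p q : ℤ}
    (ht : t = s + 1) (h : p = n + 1 - q + s) :
    comp (crossChain f g θ) s p q h =
      esign n • (f.f q).comp ((C.T q p (comp θ t q p (by omega))).comp (sdualMap (g.f p))) := by
  subst h; subst ht; rfl

theorem hypBnd_crossChain (f g : ChainMap C D) {n : ℤ} {θ : HypCh C n} (hθ : IsHypStr C n θ) :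
    hypBnd D n (crossChain f g θ) =
      fHyp (f.addCM g) n θ - (fHyp f n θ + fHyp g n θ) := by
  have key : ∀ s p q h, comp (hypBnd D n (crossChain f g θ)) s p q h =
      (f.f q).comp ((comp θ s p q h).comp (sdualMap (g.f p)))
      + (g.f q).comp ((comp θ s p q h).comp (sdualMap (f.f p))) := by
    intro s p r h
    rw [comp_hypBnd (t := s - 1) _ (by omega)]
    rw [comp_crossChain f g θ (t := s + 1) rfl, comp_crossChain f g θ (t := s + 1) rfl,
      comp_crossChain f g θ (t := s) (by omega), comp_crossChain f g θ (t := s) (by omega)]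
    rw [ChainCx.T_zsmul, ChainCx.T_conj, ChainCx.T_T]
    have h1 := f.comm r
    have h2 : (sdualMap (g.f (p + 1))).comp (sdualMap (D.d p))
        = (sdualMap (C.d p)).comp (sdualMap (g.f p)) := congrArg sdualMap (g.comm p).symm
    have H := congrArg (fun η => (f.f r).comp (η.comp (sdualMap (g.f p))))
      (transpose_cocycle hθ h)
    simp only [LinearMap.comp_add, LinearMap.add_comp, LinearMap.comp_sub, LinearMap.sub_comp,
      LinearMap.comp_smul, LinearMap.smul_comp, LinearMap.comp_assoc, LinearMap.zero_comp,
      LinearMap.comp_zero] at H ⊢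
    rw [h2]
    rw [← LinearMap.comp_assoc, h1, LinearMap.comp_assoc] at H
    rw [esign_add] at H ⊢
    rcases esign_eq_or n with hn | hn <;> rcases esign_eq_or s with hs | hs <;>
      simp only [hn, hs] at H ⊢
    · linear_combination (norm := module) (1 : ℤ) • H
    · linear_combination (norm := module) (1 : ℤ) • H
    · linear_combination (norm := module) (-1 : ℤ) • H
    · linear_combination (norm := module) (-1 : ℤ) • H
  refine ext_comp fun s p q h => (key s p q h).trans ?_
  subst h
  change _ = (f.f q + g.f q).comp ((θ s q).comp (sdualMap (f.f (n - q + s) + g.f (n - q + s))))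
    - ((f.f q).comp ((θ s q).comp (sdualMap (f.f (n - q + s))))
      + (g.f q).comp ((θ s q).comp (sdualMap (g.f (n - q + s)))))
  have hadd : sdualMap (f.f (n - q + s) + g.f (n - q + s))
      = sdualMap (f.f (n - q + s)) + sdualMap (g.f (n - q + s)) :=
    LinearMap.ext fun x => LinearMap.comp_add _ _ x
  rw [hadd, comp_self]
  simp only [LinearMap.comp_add, LinearMap.add_comp]
  abel

/-- The homomorphism of hyperquadratic chain groups induced by a chain map. -/
def fHypHom (F : ChainMap C D) (n : ℤ) : HypCh C n →+ HypCh D n where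
  toFun := fHyp F n
  map_zero' := by funext s r; simp [fHyp]
  map_add' θ η := by funext s r; simp [fHyp, LinearMap.comp_add, LinearMap.add_comp]

theorem hypCycles_le_comap (F : ChainMap C D) (n : ℤ) :
    hypCycles C n ≤ (hypCycles D n).comap (fHypHom F n) :=
  (AddSubgroup.closure_le _).2 fun _ h => AddSubgroup.subset_closure (isHypStr_fHyp F h)

theorem hypBdrys_le_comap (F : ChainMap C D) (n : ℤ) :
    hypBdrys C n ≤ (hypBdrys D n).comap (fHypHom F n) := by
  refine (AddSubgroup.closure_le _).2 ?_
  rintro _ ⟨ν, rfl⟩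
  exact AddSubgroup.subset_closure ⟨fHyp F (n + 1) ν, hypBnd_fHyp F n ν⟩

/-- The homomorphism of hyperquadratic `Q`-groups induced by a chain map. -/
def QhypMap (F : ChainMap C D) (n : ℤ) : Qhyp C n →+ Qhyp D n :=
  QuotientAddGroup.map _ _
    (((fHypHom F n).comp (hypCycles C n).subtype).codRestrict (hypCycles D n)
      fun θ => hypCycles_le_comap F n θ.2)
    fun _ hθ => hypBdrys_le_comap F n hθ

theorem isInducedHyp_QhypMap (F : ChainMap C D) (n : ℤ) : IsInducedHyp F n (QhypMap F n) :=
  fun _ _ _ => rfl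

theorem mkHyp_addCM (f g : ChainMap C D) {n : ℤ} {θ : HypCh C n} (h : IsHypStr C n θ) :
    mkHyp D n (fHyp (f.addCM g) n θ) (isHypStr_fHyp _ h) =
      mkHyp D n (fHyp f n θ) (isHypStr_fHyp f h) + mkHyp D n (fHyp g n θ) (isHypStr_fHyp g h) := by
  refine Eq.symm (QuotientAddGroup.eq.2 ?_)
  refine AddSubgroup.mem_addSubgroupOf.2
    (AddSubgroup.subset_closure ⟨crossChain f g θ, (hypBnd_crossChain f g h).trans ?_⟩)
  exact sub_eq_neg_add _ _

/-- Homomorphisms out of `Q̂^n(C)` are determined by the classes of hyperquadratic structures. -/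
theorem Qhyp_hom_ext {G : Type} [AddCommGroup G] {n : ℤ} {P Q : Qhyp C n →+ G}
    (H : ∀ θ h, P (mkHyp C n θ h) = Q (mkHyp C n θ h)) : P = Q := by
  let π : hypCycles C n →+ Qhyp C n := QuotientAddGroup.mk' _
  have hπ : Function.Surjective π := QuotientAddGroup.mk'_surjective _
  refine AddMonoidHom.ext fun x => ?_
  obtain ⟨⟨θ, hθ⟩, rfl⟩ := hπ x
  induction hθ using AddSubgroup.closure_induction with
  | mem θ h => exact H θ h
  | zero => exact ((P.comp π).map_zero).trans ((Q.comp π).map_zero).symm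
  | add a b ha hb iha ihb =>
    have hP := (P.comp π).map_add ⟨a, ha⟩ ⟨b, hb⟩
    have hQ := (Q.comp π).map_add ⟨a, ha⟩ ⟨b, hb⟩
    exact hP.trans ((congrArg₂ (· + ·) iha ihb).trans hQ.symm)
  | neg a ha iha =>
    have hP := (P.comp π).map_neg ⟨a, ha⟩
    have hQ := (Q.comp π).map_neg ⟨a, ha⟩
    exact hP.trans ((congrArg Neg.neg iha).trans hQ.symm)

end HypCh

/-- For any chain maps `f, g : C → D` of finite-dimensional `A`-module chain
complexes and every `n`, the induced maps on the hyperquadratic `Q`-groups are additive in the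
chain map: `(f+g)̂^% = f̂^% + ĝ^% : Q̂^n(C) → Q̂^n(D)`. -/
theorem stmt5 (A : Type) [Ring A] [StarRing A] {C D : ChainCx A}
    (f g : ChainMap C D) (n : ℤ) :
    (∃ Q, IsInducedHyp (f.addCM g) n Q) ∧
    (∃ Q, IsInducedHyp f n Q) ∧ (∃ Q, IsInducedHyp g n Q) ∧
    (∀ (Qfg Qf Qg : Qhyp C n →+ Qhyp D n),
      IsInducedHyp (f.addCM g) n Qfg → IsInducedHyp f n Qf → IsInducedHyp g n Qg →
        Qfg = Qf + Qg) := by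
  refine ⟨⟨_, HypCh.isInducedHyp_QhypMap _ n⟩, ⟨_, HypCh.isInducedHyp_QhypMap f n⟩,
    ⟨_, HypCh.isInducedHyp_QhypMap g n⟩, fun Qfg Qf Qg hfg hf hg => ?_⟩
  refine HypCh.Qhyp_hom_ext fun θ h => ?_
  rw [AddMonoidHom.add_apply, hfg θ h (HypCh.isHypStr_fHyp _ h),
    hf θ h (HypCh.isHypStr_fHyp f h), hg θ h (HypCh.isHypStr_fHyp g h), HypCh.mkHyp_addCM f g h]
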